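/- If a finite simple graph on n vertices contains no even-length cycle, then it has at most ⌊3(n-1)/2⌋ edges; in particular the number of edges is O(n). -/

import Mathlib

namespace SimpleGraph

variable {V : Type*} {G : SimpleGraph V}

/-- Two positions on a path are joined by the segment of the path between them. -/
lemma Walk.IsPath.exists_isPath_getVert_getVert {u v : V} {p : G.Walk u v} (hp : p.IsPath)
    {i j : ℕ} (hij : i ≤ j) (hj : j ≤ p.length) :
    ∃ q : G.Walk (p.getVert i) (p.getVert j), q.IsPath ∧ q.length = j - i ∧
      ∀ x ∈ q.support, ∃ m, i ≤ m ∧ m ≤ j ∧ x = p.getVert m := by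
  induction j, hij using Nat.le_induction with
  | base => exact ⟨.nil, by simp, by simp, fun x hx => ⟨i, le_rfl, le_rfl, by simpa using hx⟩⟩
  | succ j hij ih =>
    obtain ⟨q, hq, hlen, hsupp⟩ := ih (by omega)
    refine ⟨q.concat (p.adj_getVert_succ (by omega)), hq.concat ?_ _, ?_, ?_⟩
    · intro hmem
      obtain ⟨m, him, hmj, heq⟩ := hsupp _ hmem
      have := hp.getVert_injOn (show j + 1 ≤ p.length from hj) (show m ≤ p.length by omega) heq
      omega
    · rw [Walk.length_concat]; omega
    · intro x hx
      rw [Walk.support_concat, List.mem_append, List.mem_singleton] at hx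
      rcases hx with hx | rfl
      · obtain ⟨m, him, hmj, heq⟩ := hsupp _ hx
        exact ⟨m, him, by omega, heq⟩
      · exact ⟨j + 1, by omega, le_rfl, rfl⟩

/-- In a graph without even cycles, a path of length at least two between adjacent vertices has
even length. -/
lemma Walk.IsPath.even_length_of_adj
    (h : ∀ (a : V) (p : G.Walk a a), p.IsCycle → ¬ Even p.length)
    {u v : V} {p : G.Walk u v} (hp : p.IsPath) (hadj : G.Adj v u) (hlen : 2 ≤ p.length) :
    Even p.length := by
  have hc : (Walk.cons hadj p).IsCycle := by
    refine (Walk.cons_isCycle_iff _ _).2 ⟨hp, fun he => ?_⟩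
    have := (hp.getVert_eq_start_iff (i := p.length - 1) (by omega)).1
      (hp.eq_penultimate_of_mem_edges he).symm
    omega
  have := h _ _ hc
  rw [Walk.length_cons, Nat.even_add_one, not_not] at this
  exact this

/-- A vertex off a path sees only positions of alternating parity on it. -/
lemma Walk.IsPath.odd_sub_of_adj_of_adj
    (h : ∀ (a : V) (p : G.Walk a a), p.IsCycle → ¬ Even p.length)
    {u v x : V} {p : G.Walk u v} (hp : p.IsPath) (hx : x ∉ p.support) {i j : ℕ} (hij : i < j)
    (hj : j ≤ p.length) (hi' : G.Adj x (p.getVert i)) (hj' : G.Adj x (p.getVert j)) :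
    Odd (j - i) := by
  obtain ⟨q, hq, hlen, hsupp⟩ := hp.exists_isPath_getVert_getVert hij.le hj
  have hxq : x ∉ q.support := fun hmem => by
    obtain ⟨m, -, -, rfl⟩ := hsupp _ hmem
    exact hx (p.getVert_mem_support m)
  have := (hq.cons (h := hi') hxq).even_length_of_adj h hj'.symm (by rw [Walk.length_cons]; omega)
  rw [Walk.length_cons, hlen, Nat.even_add_one, Nat.not_even_iff_odd] at this
  exact this

/-- A neighbor of the start of a path, off the path and with another neighbor on the path,
cannot share these properties with a second vertex. -/
lemma Walk.IsPath.eq_of_adj_start_of_adj_getVert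
    (h : ∀ (a : V) (p : G.Walk a a), p.IsCycle → ¬ Even p.length)
    {u v x y : V} {p : G.Walk u v} (hp : p.IsPath) (hx : x ∉ p.support) (hy : y ∉ p.support)
    {i j : ℕ} (hi : 0 < i) (hij : i ≤ j) (hj : j ≤ p.length) (hxu : G.Adj x u) (hyu : G.Adj y u)
    (hxi : G.Adj x (p.getVert i)) (hyj : G.Adj y (p.getVert j)) : x = y := by
  by_contra hxy
  obtain ⟨q, hq, hlen, hsupp⟩ := hp.exists_isPath_getVert_getVert hij hj
  have hoff : ∀ z ∉ p.support, z ∉ q.support := fun z hz hmem => by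
    obtain ⟨m, -, -, rfl⟩ := hsupp _ hmem
    exact hz (p.getVert_mem_support m)
  have hu : u ∉ q.support := fun hmem => by
    obtain ⟨m, him, hmj, heq⟩ := hsupp _ hmem
    have := (hp.getVert_eq_start_iff (i := m) (by omega)).1 heq.symm
    omega
  have hodd_i := hp.odd_sub_of_adj_of_adj h hx hi (by omega) (by simpa using hxu) hxi
  have hodd_j := hp.odd_sub_of_adj_of_adj h hy (hi.trans_le hij) hj (by simpa using hyu) hyj
  have hux : u ∉ (Walk.cons hxi q).support := by simp [hu, hxu.ne']
  have hyx : y ∉ (Walk.cons hxu.symm (Walk.cons hxi q)).support := by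
    simp [hoff y hy, hyu.ne, Ne.symm hxy]
  have := (((hq.cons (h := hxi) (hoff x hx)).cons (h := hxu.symm) hux).cons
    (h := hyu) hyx).even_length_of_adj h hyj.symm (by simp)
  simp only [Walk.length_cons, hlen] at this
  grind

/-- If a vertex off a path is adjacent to the start of the path and to a later vertex, then the
path has no chord at its start. -/
lemma Walk.IsPath.not_adj_start_getVert_of_adj
    (h : ∀ (a : V) (p : G.Walk a a), p.IsCycle → ¬ Even p.length)
    {u v x : V} {p : G.Walk u v} (hp : p.IsPath) (hx : x ∉ p.support)
    {i j : ℕ} (hi : 0 < i) (hi' : i ≤ p.length) (hj : 2 ≤ j) (hj' : j ≤ p.length)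
    (hxu : G.Adj x u) (hxi : G.Adj x (p.getVert i)) : ¬ G.Adj u (p.getVert j) := by
  intro huj
  have hodd_i := hp.odd_sub_of_adj_of_adj h hx hi hi' (by simpa using hxu) hxi
  have heven_j : Even j := by
    obtain ⟨q, hq, hlen, -⟩ := hp.exists_isPath_getVert_getVert (Nat.zero_le j) hj'
    have := hq.even_length_of_adj h (by simpa using huj.symm) (by omega)
    simpa [hlen] using this
  have key : ∀ q : G.Walk (p.getVert i) (p.getVert j), q.IsPath →
      (∀ z ∈ q.support, ∃ m, 0 < m ∧ m ≤ p.length ∧ z = p.getVert m) → Even q.length := by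
    intro q hq hsupp
    have hxq : x ∉ q.support := fun hmem => by
      obtain ⟨m, -, -, rfl⟩ := hsupp _ hmem
      exact hx (p.getVert_mem_support m)
    have hu : u ∉ (Walk.cons hxi q).support := fun hmem => by
      rw [Walk.support_cons, List.mem_cons] at hmem
      obtain ⟨m, him, hmj, heq⟩ := hsupp _ (hmem.resolve_left hxu.ne')
      have := (hp.getVert_eq_start_iff hmj).1 heq.symm
      omega
    have := ((hq.cons (h := hxi) hxq).cons (h := hxu.symm) hu).even_length_of_adj h huj.symm
      (by simp)
    simp only [Walk.length_cons] at this
    grind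
  rcases le_total i j with hij | hji
  · obtain ⟨q, hq, hlen, hsupp⟩ := hp.exists_isPath_getVert_getVert hij hj'
    have := key q hq fun z hz => by
      obtain ⟨m, _, _, rfl⟩ := hsupp z hz
      exact ⟨m, by omega, by omega, rfl⟩
    grind
  · obtain ⟨q, hq, hlen, hsupp⟩ := hp.exists_isPath_getVert_getVert hji hi'
    have := key q.reverse hq.reverse fun z hz => by
      obtain ⟨m, _, _, rfl⟩ := hsupp z (by simpa using hz)
      exact ⟨m, by omega, by omega, rfl⟩
    rw [Walk.length_reverse] at this
    grind

lemma ncard_edgeSet_le_deleteEdges [Finite V] (G : SimpleGraph V) (s : Set (Sym2 V)) :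
    G.edgeSet.ncard ≤ (G.deleteEdges s).edgeSet.ncard + s.ncard := by
  rw [edgeSet_deleteEdges]
  exact Set.ncard_le_ncard_sdiff_add_ncard _ _

/-- A graph without even cycles whose edges lie in a nonempty vertex set `S` has at most
`3 (|S| - 1) / 2` edges. -/
lemma two_mul_ncard_edgeSet_add_three_le [Finite V] [DecidableEq V] (S : Finset V) :
    ∀ (G : SimpleGraph V), S.Nonempty → (∀ a b, G.Adj a b → a ∈ S) →
      (∀ (a : V) (p : G.Walk a a), p.IsCycle → ¬ Even p.length) →
      2 * G.edgeSet.ncard + 3 ≤ 3 * S.card := by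
  induction S using Finset.strongInduction with
  | H S ih =>
  intro G hS hGS h
  have hcard := hS.card_pos
  have hdel : ∀ s : Set (Sym2 V), ∀ (a : V) (p : (G.deleteEdges s).Walk a a),
      p.IsCycle → ¬ Even p.length := fun s a p hp => by
    simpa using h a (p.mapLe (G.deleteEdges_le s)) (hp.mapLe _)
  have : Nonempty V := hS.to_type
  obtain ⟨x, v, p, hp, hmax⟩ := Walk.exists_isPath_forall_isPath_length_le_length G
  cases p with
  | nil =>
    have : G = ⊥ := by
      ext a b
      simp only [bot_adj, iff_false]
      intro hab
      simpa using hmax _ _ hab.toWalk (by simp [hab.ne])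
    subst this
    simp; omega
  | @cons _ b _ hxb q =>
  obtain ⟨hq, hx⟩ := (Walk.cons_isPath_iff _ _).1 hp
  have hnbr : ∀ y, y ∉ q.support → G.Adj y b → ∀ z, G.Adj y z →
      ∃ i, q.getVert i = z ∧ i ≤ q.length := by
    intro y hy hyb z hyz
    rw [← Walk.mem_support_iff_exists_getVert]
    by_contra hz
    have := hmax _ _ _ ((hq.cons (h := hyb) hy).cons (h := hyz.symm) (by simp [hz, hyz.ne']))
    simp at this
  by_cases hleaf : ∃ y, y ∉ q.support ∧ G.Adj y b ∧ ∀ z, G.Adj y z → z = b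
  · obtain ⟨y, -, hyb, hy⟩ := hleaf
    have hyS := hGS _ _ hyb
    have := ih (S.erase y) (Finset.erase_ssubset hyS) (G.deleteEdges {s(y, b)})
      ⟨b, Finset.mem_erase.2 ⟨hyb.ne', hGS _ _ hyb.symm⟩⟩ (fun a c hac => by
        rw [deleteEdges_adj] at hac
        refine Finset.mem_erase.2 ⟨?_, hGS _ _ hac.1⟩
        rintro rfl
        exact hac.2 (by simp [hy c hac.1])) (hdel _)
    rw [Finset.card_erase_of_mem hyS] at this
    have hle := G.ncard_edgeSet_le_deleteEdges {s(y, b)}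
    rw [Set.ncard_singleton] at hle
    omega
  push Not at hleaf
  have hsecond : ∀ y, y ∉ q.support → G.Adj y b →
      ∃ i, 0 < i ∧ i ≤ q.length ∧ G.Adj y (q.getVert i) := by
    intro y hy hyb
    obtain ⟨z, hyz, hzb⟩ := hleaf y hy hyb
    obtain ⟨i, rfl, hi⟩ := hnbr y hy hyb z hyz
    refine ⟨i, Nat.pos_of_ne_zero ?_, hi, hyz⟩
    rintro rfl
    simp at hzb
  obtain ⟨i, hi, hil, hxi⟩ := hsecond x hx hxb
  have hxnbr : ∀ z, G.Adj x z → z = b ∨ z = q.getVert i := by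
    intro z hxz
    obtain ⟨j, rfl, hj⟩ := hnbr x hx hxb z hxz
    by_contra! hne
    have hj0 : 0 < j := Nat.pos_of_ne_zero fun h0 => hne.1 (by simp [h0])
    have hji : j ≠ i := fun h0 => hne.2 (by rw [h0])
    have hb0 : G.Adj x (q.getVert 0) := by simpa using hxb
    have h1 := hq.odd_sub_of_adj_of_adj h hx hi hil hb0 hxi
    have h2 := hq.odd_sub_of_adj_of_adj h hx hj0 hj hb0 hxz
    rcases hji.lt_or_gt with hlt | hlt
    · have := hq.odd_sub_of_adj_of_adj h hx hlt hil hxz hxi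
      grind
    · have := hq.odd_sub_of_adj_of_adj h hx hlt hj hxi hxz
      grind
  have hbnbr : ∀ z, G.Adj b z → z = x ∨ z = q.getVert 1 := by
    intro z hbz
    by_cases hz : z ∈ q.support
    · obtain ⟨j, rfl, hj⟩ := Walk.mem_support_iff_exists_getVert.1 hz
      have hj0 : j ≠ 0 := by rintro rfl; simp at hbz
      have hj2 : ¬ 2 ≤ j := fun hj2 =>
        hq.not_adj_start_getVert_of_adj h hx hi hil hj2 hj hxb hxi hbz
      obtain rfl : j = 1 := by omega
      exact .inr rfl
    · obtain ⟨j, hj, hjl, hzj⟩ := hsecond z hz hbz.symm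
      left
      rcases le_total i j with hij | hji
      · exact (hq.eq_of_adj_start_of_adj_getVert h hx hz hi hij hjl hxb hbz.symm hxi hzj).symm
      · exact hq.eq_of_adj_start_of_adj_getVert h hz hx hj hji hil hbz.symm hxb hzj hxi
  have hxS := hGS _ _ hxb
  have hbS : b ∈ S.erase x := Finset.mem_erase.2 ⟨hxb.ne', hGS _ _ hxb.symm⟩
  have hb1 : G.Adj b (q.getVert 1) := by
    simpa using q.adj_getVert_succ (i := 0) (by omega)
  have hx1 : q.getVert 1 ≠ x := fun h1 => hx (h1 ▸ q.getVert_mem_support 1)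
  let s : Set (Sym2 V) := {s(x, b), s(x, q.getVert i), s(b, q.getVert 1)}
  have := ih ((S.erase x).erase b)
    ((Finset.erase_subset _ _).trans_ssubset (Finset.erase_ssubset hxS)) (G.deleteEdges s)
    ⟨q.getVert 1, by simp [hb1.ne', hx1, hGS _ _ hb1.symm]⟩ (fun a c hac => by
      rw [deleteEdges_adj] at hac
      refine Finset.mem_erase.2 ⟨?_, Finset.mem_erase.2 ⟨?_, hGS _ _ hac.1⟩⟩
      · rintro rfl
        apply hac.2
        rcases hbnbr c hac.1 with rfl | rfl <;> simp [s, Sym2.eq_swap]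
      · rintro rfl
        apply hac.2
        rcases hxnbr c hac.1 with rfl | rfl <;> simp [s]) (hdel _)
  rw [Finset.card_erase_of_mem hbS, Finset.card_erase_of_mem hxS] at this
  have hle := G.ncard_edgeSet_le_deleteEdges s
  have hs : s.ncard ≤ 3 := (Set.ncard_insert_le _ _).trans
    (Nat.succ_le_succ ((Set.ncard_insert_le _ _).trans
      (by rw [Set.ncard_singleton])))
  omega

end SimpleGraph

/-- A finite simple graph on `n` vertices with no even-length cycle has at most
`⌊3(n-1)/2⌋` edges. -/
theorem edge_bound_of_no_even_cycle {V : Type*} [Fintype V] (G : SimpleGraph V)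
    (h : ∀ (a : V) (p : G.Walk a a), p.IsCycle → ¬ Even p.length) :
    G.edgeSet.ncard ≤ 3 * (Fintype.card V - 1) / 2 := by
  classical
  rcases isEmpty_or_nonempty V with hV | hV
  · simp [Subsingleton.elim G ⊥]
  · have := SimpleGraph.two_mul_ncard_edgeSet_add_three_le Finset.univ G Finset.univ_nonempty
      (fun a _ _ => Finset.mem_univ a) h
    rw [Finset.card_univ] at this
    omega
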